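/- Suppose (p = 2 and 4 ≤ k ≤ q−3) or (p odd and 3 ≤ k ≤ q−2), and suppose either (a_{11}a_{21}a_{22} ≠ 0 and a_{12} = 0) or (a_{12}a_{21}a_{22} ≠ 0 and a_{11} = 0). Then the minimum distance of RL_k^⊥(F_q^*, M) equals k, and the number of codewords of Hamming weight exactly k in RL_k^⊥(F_q^*, M) equals ((q−1)/q)·C(q−1, k−1) + (−1)^{k+⌊(k−1)/p⌋}·((q−1)/q)·C(q/p − 1, ⌊(k−1)/p⌋), where C(·,·) denotes the binomial coefficient. -/

import Mathlib

section
open Polynomial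

lemma rl_prod_range {R : Type*} [CommRing R] [IsDomain R] {p : ℕ} (hp : 0 < p) {ζ : R}
    (h : IsPrimitiveRoot ζ p) (y : R) :
    ∏ i ∈ Finset.range p, (1 - ζ ^ i * y) = 1 - y ^ p := by
  classical
  have h1 := h.pow_sub_pow_eq_prod_sub_mul 1 y hp
  rw [one_pow] at h1
  rw [h1]
  refine Finset.prod_bij (fun i _ => ζ ^ i) ?_ ?_ ?_ ?_
  · intro i hi
    rw [Polynomial.mem_nthRootsFinset hp, ← pow_mul, mul_comm, pow_mul, h.pow_eq_one, one_pow]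
  · intro i hi j hj hij
    exact h.pow_inj (Finset.mem_range.1 hi) (Finset.mem_range.1 hj) hij
  · intro b hb
    have : NeZero p := ⟨hp.ne'⟩
    rw [Polynomial.mem_nthRootsFinset hp] at hb
    obtain ⟨i, hi, hib⟩ := h.eq_pow_of_pow_eq_one hb
    exact ⟨i, Finset.mem_range.2 hi, hib⟩
  · intro i hi
    rfl

lemma rl_prod_full {F : Type*} [Field F] [Fintype F] {p : ℕ} (hp : p.Prime) [CharP F p]
    (n : ℕ) (hn : Fintype.card F = p * n) (ψ : AddChar F ℂ) (a : F) (ha : ψ a ≠ 1) :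
    ∏ x : F, (1 - C (ψ x) * X : ℂ[X]) = (1 - X ^ p) ^ n := by
  have hpow : ∀ x, ψ x ^ p = 1 := by
    intro x
    rw [← AddChar.map_nsmul_eq_pow]
    simp
  have hprim : IsPrimitiveRoot (ψ a) p := by
    have := Fact.mk hp
    exact IsPrimitiveRoot.iff_orderOf.2 (orderOf_eq_prime (hpow a) ha)
  have hprimC : IsPrimitiveRoot (C (ψ a) : ℂ[X]) p :=
    hprim.map_of_injective (f := (C : ℂ →+* ℂ[X])) C_injective
  set P : ℂ[X] := ∏ x : F, (1 - C (ψ x) * X : ℂ[X]) with hP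
  have hshift : ∀ i : ℕ, P = ∏ x : F, (1 - C (ψ a) ^ i * (C (ψ x) * X) : ℂ[X]) := by
    intro i
    rw [hP, ← Equiv.prod_comp (Equiv.addLeft (i • a))]
    refine Finset.prod_congr rfl fun x _ => ?_
    simp only [Equiv.coe_addLeft, AddChar.map_add_eq_mul, AddChar.map_nsmul_eq_pow, C_mul, C_pow]
    ring
  have hpp : P ^ p = ((1 - X ^ p) ^ n) ^ p := by
    calc P ^ p = ∏ i ∈ Finset.range p, P := by simp
      _ = ∏ i ∈ Finset.range p, ∏ x : F, (1 - C (ψ a) ^ i * (C (ψ x) * X) : ℂ[X]) :=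
        Finset.prod_congr rfl fun i _ => hshift i
      _ = ∏ x : F, ∏ i ∈ Finset.range p, (1 - C (ψ a) ^ i * (C (ψ x) * X) : ℂ[X]) :=
        Finset.prod_comm
      _ = ∏ x : F, (1 - X ^ p : ℂ[X]) := by
        refine Finset.prod_congr rfl fun x _ => ?_
        rw [rl_prod_range hp.pos hprimC, mul_pow, ← C_pow, hpow]
        simp
      _ = _ := by
        rw [Finset.prod_const, Finset.card_univ, hn, ← pow_mul, mul_comm]
  have hd : P ∣ (1 - X ^ p) ^ n :=
    (IsIntegrallyClosed.pow_dvd_pow_iff hp.ne_zero).1 (dvd_of_eq hpp)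
  have hd2 : (1 - X ^ p) ^ n ∣ P :=
    (IsIntegrallyClosed.pow_dvd_pow_iff hp.ne_zero).1 (dvd_of_eq hpp.symm)
  obtain ⟨u, hu⟩ := associated_of_dvd_dvd hd hd2
  obtain ⟨r, hr, hru⟩ := Polynomial.isUnit_iff.1 u.isUnit
  rw [← hru] at hu
  have h0 := congrArg (Polynomial.eval 0) hu
  simp only [hP, eval_mul, eval_prod, eval_C, eval_pow, eval_sub, eval_one, eval_X] at h0
  simp [hp.ne_zero] at h0
  rw [← hu, h0]; simp

lemma rl_coeff {p n : ℕ} (hp : 0 < p) (j : ℕ) :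
    ((∑ i ∈ Finset.range p, (X : ℂ[X]) ^ i) * (1 - X ^ p) ^ n).coeff j
      = (-1) ^ (j / p) * (n.choose (j / p) : ℂ) := by
  have h1 : ((1 : ℂ[X]) - X ^ p) ^ n
      = ∑ l ∈ Finset.range (n + 1), C ((-1) ^ l * (n.choose l : ℂ)) * X ^ (p * l) := by
    rw [sub_eq_neg_add, add_pow]
    refine Finset.sum_congr rfl fun l _ => ?_
    rw [neg_pow, ← pow_mul]
    simp
    ring
  rw [h1, Finset.sum_mul_sum]
  simp only [finsetSum_coeff]
  have h2 : ∀ i l : ℕ, i < p → (X ^ i * (C ((-1) ^ l * (n.choose l : ℂ)) * X ^ (p * l)) : ℂ[X]).coeff j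
      = if i = j % p ∧ l = j / p then (-1) ^ (j / p) * (n.choose (j / p) : ℂ) else 0 := by
    intro i l hi
    have : (X ^ i * (C ((-1) ^ l * (n.choose l : ℂ)) * X ^ (p * l)) : ℂ[X])
      = C ((-1) ^ l * (n.choose l : ℂ)) * X ^ (i + p * l) := by ring
    rw [this, coeff_C_mul_X_pow]
    have hiff : j = i + p * l ↔ (i = j % p ∧ l = j / p) := by
      constructor
      · rintro rfl
        rw [Nat.add_mul_mod_self_left, Nat.mod_eq_of_lt hi, Nat.add_mul_div_left _ _ hp,
          Nat.div_eq_of_lt hi]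
        simp
      · rintro ⟨rfl, rfl⟩
        exact (Nat.mod_add_div j p).symm
    by_cases hc : j = i + p * l
    · rw [if_pos hc, if_pos (hiff.1 hc), (hiff.1 hc).2]
    · rw [if_neg hc, if_neg (fun h => hc (hiff.2 h))]
  rw [Finset.sum_eq_single (j % p)]
  · by_cases hl : j / p < n + 1
    · rw [Finset.sum_eq_single (j / p)]
      · rw [h2 _ _ (Nat.mod_lt _ hp)]; simp
      · intro l _ hl'
        rw [h2 _ _ (Nat.mod_lt _ hp), if_neg (by tauto)]
      · intro h; exact absurd (Finset.mem_range.2 hl) h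
    · rw [Nat.choose_eq_zero_of_lt (by omega)]
      simp only [Nat.cast_zero, mul_zero]
      refine Finset.sum_eq_zero fun l hl' => ?_
      rw [h2 _ _ (Nat.mod_lt _ hp), if_neg]
      rintro ⟨_, rfl⟩
      exact hl (Finset.mem_range.1 hl')
  · intro i hi hij
    refine Finset.sum_eq_zero fun l hl' => ?_
    rw [h2 _ _ (Finset.mem_range.1 hi), if_neg (by tauto)]
  · intro h; exact absurd (Finset.mem_range.2 (Nat.mod_lt _ hp)) h

lemma rl_map_sum {F : Type*} [Field F] (ψ : AddChar F ℂ) (S : Finset F) :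
    ψ (∑ x ∈ S, x) = ∏ x ∈ S, ψ x := by
  classical
  induction S using Finset.induction_on with
  | empty => simp
  | insert a S ha ih => rw [Finset.sum_insert ha, Finset.prod_insert ha, AddChar.map_add_eq_mul, ih]

lemma rl_charsum {F : Type*} [Field F] [Fintype F] [DecidableEq F] {p : ℕ} (hp : p.Prime) [CharP F p]
    (n : ℕ) (hn : Fintype.card F = p * (n + 1)) (ψ : AddChar F ℂ) (a : F) (ha : ψ a ≠ 1) (j : ℕ) :
    (-1) ^ j * ∑ S ∈ (Finset.univ.erase (0 : F)).powersetCard j, ψ (∑ x ∈ S, x)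
      = (-1) ^ (j / p) * (n.choose (j / p) : ℂ) := by
  have h1 := rl_prod_full hp (n + 1) hn ψ a ha
  rw [← Finset.mul_prod_erase _ _ (Finset.mem_univ (0 : F))] at h1
  have h2 : ∏ x ∈ Finset.univ.erase (0 : F), (1 - C (ψ x) * X : ℂ[X])
      = (∑ i ∈ Finset.range p, (X : ℂ[X]) ^ i) * (1 - X ^ p) ^ n := by
    have hne : (1 - X : ℂ[X]) ≠ 0 := by
      intro h
      have := congrArg (Polynomial.eval 0) h
      simp at this
    apply mul_left_cancel₀ hne
    rw [← mul_assoc, mul_neg_geom_sum, ← pow_succ', ← h1]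
    simp
  rw [← rl_coeff hp.pos, ← h2]
  have h3 : ∏ x ∈ Finset.univ.erase (0 : F), (1 - C (ψ x) * X : ℂ[X])
      = ∑ S ∈ (Finset.univ.erase (0 : F)).powerset, C ((-1) ^ S.card * ψ (∑ x ∈ S, x)) * X ^ S.card := by
    have : ∀ x : F, (1 - C (ψ x) * X : ℂ[X]) = 1 + C (-ψ x) * X := by intro x; simp; ring
    simp_rw [this]
    rw [Finset.prod_one_add]
    refine Finset.sum_congr rfl fun S _ => ?_
    rw [Finset.prod_mul_distrib, Finset.prod_const, ← map_prod, Finset.prod_neg]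
    congr 3
    exact (rl_map_sum ψ S).symm
  rw [h3, finsetSum_coeff]
  simp_rw [coeff_C_mul_X_pow]
  rw [← Finset.sum_filter, Finset.mul_sum]
  have h4 : (Finset.univ.erase (0 : F)).powersetCard j
      = (Finset.univ.erase (0 : F)).powerset.filter (fun S => j = S.card) := by
    ext S; simp [Finset.mem_powersetCard, eq_comm]
  rw [h4]
  refine Finset.sum_congr rfl fun S hS => ?_
  rw [← (Finset.mem_filter.1 hS).2]

/-- number of `j`-subsets of `F*` with sum `b` -/
def rlN {F : Type*} [Field F] [Fintype F] [DecidableEq F] (j : ℕ) (b : F) : Finset (Finset F) :=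
  ((Finset.univ.erase (0 : F)).powersetCard j).filter (fun S => ∑ x ∈ S, x = b)

lemma rlN_card {F : Type*} [Field F] [Fintype F] [DecidableEq F] (j : ℕ) (b b' : F) (hb : b ≠ 0)
    (hb' : b' ≠ 0) : (rlN j b).card ≤ (rlN j b').card := by
  have hc : b' / b ≠ 0 := div_ne_zero hb' hb
  have hinj : Function.Injective (fun x : F => (b' / b) * x) := mul_right_injective₀ hc
  refine Finset.card_le_card_of_injOn (fun S => S.image (fun x => (b' / b) * x)) ?_ ?_
  · intro S hS
    simp only [rlN, Finset.coe_filter, Set.mem_ofPred_eq, Finset.mem_powersetCard] at hS ⊢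
    obtain ⟨⟨hS1, hS2⟩, hS3⟩ := hS
    refine ⟨⟨?_, ?_⟩, ?_⟩
    · intro y hy
      obtain ⟨x, hx, rfl⟩ := Finset.mem_image.1 hy
      have := hS1 hx
      simp at this
      simp [this, hb, hb']
    · rw [Finset.card_image_of_injective _ hinj, hS2]
    · rw [Finset.sum_image (fun x _ y _ h => hinj h), ← Finset.mul_sum, hS3]
      field_simp
  · intro S _ T _ h
    exact Finset.image_injective hinj h

lemma rlN_count {F : Type*} [Field F] [Fintype F] [DecidableEq F] {p : ℕ} (hp : p.Prime) [CharP F p]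
    (n : ℕ) (hn : Fintype.card F = p * (n + 1)) (j : ℕ) (b : F) (hb : b ≠ 0) :
    (Fintype.card F : ℚ) * (rlN j b).card = (Fintype.card F - 1).choose j
      - (-1) ^ (j + j / p) * (n.choose (j / p)) := by
  have heq : ∀ b' ∈ Finset.univ.erase (0 : F), (rlN j b').card = (rlN j b).card := fun b' hb' =>
    le_antisymm (rlN_card j _ _ (Finset.ne_of_mem_erase hb') hb)
      (rlN_card j _ _ hb (Finset.ne_of_mem_erase hb'))
  have hcardE : (Finset.univ.erase (0 : F)).card = Fintype.card F - 1 := by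
    rw [Finset.card_erase_of_mem (Finset.mem_univ _), Finset.card_univ]
  have htot : (rlN j (0 : F)).card + (Fintype.card F - 1) * (rlN j b).card
      = (Fintype.card F - 1).choose j := by
    have h1 := Finset.card_eq_sum_card_fiberwise
      (s := (Finset.univ.erase (0 : F)).powersetCard j) (f := fun S => ∑ x ∈ S, x)
      (t := Finset.univ) (fun _ _ => Finset.mem_coe.2 (Finset.mem_univ _))
    rw [Finset.card_powersetCard, hcardE, ← Finset.add_sum_erase _ _ (Finset.mem_univ (0 : F))] at h1
    rw [h1]
    congr 1
    rw [← hcardE, ← smul_eq_mul, ← Finset.sum_const]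
    exact Finset.sum_congr rfl fun b' hb' => (heq b' hb').symm
  obtain ⟨ψ, hψ⟩ := (AddChar.exists_apply_ne_zero (a := (1 : F))).2 one_ne_zero
  have hψ1 : ψ ≠ 0 := by rintro rfl; simp at hψ
  have hchar := rl_charsum hp n hn ψ 1 hψ j
  have hsum0 : ∑ x : F, ψ x = 0 := by
    rw [AddChar.sum_eq_zero_iff_ne_zero]; exact hψ1
  have hs : ∑ S ∈ (Finset.univ.erase (0 : F)).powersetCard j, ψ (∑ x ∈ S, x)
      = (rlN j (0 : F)).card - (rlN j b).card := by
    rw [← Finset.sum_fiberwise_of_maps_to (g := fun S => ∑ x ∈ S, x) (t := Finset.univ)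
        (fun _ _ => Finset.mem_univ _)]
    have : ∀ b' : F, ∑ S ∈ ((Finset.univ.erase (0 : F)).powersetCard j).filter
        (fun S => ∑ x ∈ S, x = b'), ψ (∑ x ∈ S, x) = (rlN j b').card * ψ b' := by
      intro b'
      rw [Finset.sum_congr rfl (g := fun _ => ψ b')
        (fun S hS => by rw [(Finset.mem_filter.1 hS).2])]
      simp [rlN]
    simp_rw [this]
    rw [← Finset.add_sum_erase _ _ (Finset.mem_univ (0 : F)),
      Finset.sum_congr rfl (g := fun b' => ((rlN j b).card : ℂ) * ψ b')
        (fun b' hb' => by rw [heq b' hb']), ← Finset.mul_sum]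
    rw [← Finset.add_sum_erase _ _ (Finset.mem_univ (0 : F))] at hsum0
    rw [eq_neg_of_add_eq_zero_right hsum0]
    simp
    ring
  rw [hs] at hchar
  have hq : 1 ≤ Fintype.card F := Fintype.card_pos
  have hD : ((rlN j (0 : F)).card : ℚ) - (rlN j b).card = (-1) ^ (j + j / p) * (n.choose (j / p)) := by
    have : (-1 : ℂ) ^ j * ((-1) ^ j * (((rlN j (0 : F)).card : ℂ) - (rlN j b).card)) =
        (-1 : ℂ) ^ j * ((-1) ^ (j / p) * (n.choose (j / p) : ℂ)) := by rw [hchar]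
    rw [← mul_assoc, ← mul_assoc, ← mul_pow, ← pow_add] at this
    norm_num at this
    exact_mod_cast this
  rw [← hD, ← htot]
  push_cast [Nat.cast_sub hq]
  ring

lemma rlN_nonempty {F : Type*} [Field F] [Fintype F] [DecidableEq F] (j : ℕ) (b : F) (hb : b ≠ 0)
    (hj : 1 ≤ j) (hj2 : j < Fintype.card F - 1) : (rlN j b).Nonempty := by
  have hcardE : (Finset.univ.erase (0 : F)).card = Fintype.card F - 1 := by
    rw [Finset.card_erase_of_mem (Finset.mem_univ _), Finset.card_univ]
  suffices h : ∃ S ∈ (Finset.univ.erase (0 : F)).powersetCard j, ∑ x ∈ S, x ≠ 0 by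
    obtain ⟨S, hS, hS0⟩ := h
    have h1 : 0 < (rlN j (∑ x ∈ S, x)).card :=
      Finset.card_pos.2 ⟨S, Finset.mem_filter.2 ⟨hS, rfl⟩⟩
    exact Finset.card_pos.1 (h1.trans_le (rlN_card j _ _ hS0 hb))
  obtain ⟨T, hTs, hT⟩ := Finset.exists_subset_card_eq (s := Finset.univ.erase (0 : F)) (n := j + 1)
    (by omega)
  obtain ⟨x, hx⟩ : T.Nonempty := Finset.card_pos.1 (by omega)
  obtain ⟨y, hy⟩ : (T.erase x).Nonempty := Finset.card_pos.1 (by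
    rw [Finset.card_erase_of_mem hx]; omega)
  obtain ⟨hyx, hyT⟩ := Finset.mem_erase.1 hy
  by_contra! hcon
  have key : ∀ z ∈ T, ∑ w ∈ T.erase z, w = 0 := fun z hz => hcon _ (Finset.mem_powersetCard.2
    ⟨(Finset.erase_subset _ _).trans hTs, by rw [Finset.card_erase_of_mem hz]; omega⟩)
  have e1 := Finset.add_sum_erase T (fun w => w) hx
  have e2 := Finset.add_sum_erase T (fun w => w) hyT
  rw [key x hx] at e1
  rw [key y hyT] at e2
  apply hyx
  simp only [add_zero] at e1 e2
  rw [e1, e2]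

lemma rl_vand {F : Type*} [Field F] [DecidableEq F] (S : Finset F) (v : F → F)
    (h : ∀ i < S.card, ∑ x ∈ S, v x * x ^ i = 0) : ∀ x ∈ S, v x = 0 := by
  intro x hx
  have hinj : Set.InjOn (fun y : F => y) (S : Set F) := fun _ _ _ _ h => h
  set P := Lagrange.basis S (fun y : F => y) x with hP
  have hdeg : P.natDegree < S.card := by
    rw [hP, Lagrange.natDegree_basis hinj hx]
    have := Finset.card_pos.2 ⟨x, hx⟩
    omega
  have h1 : ∑ y ∈ S, v y * P.eval y = 0 := by
    simp_rw [Polynomial.eval_eq_sum_range' hdeg, Finset.mul_sum]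
    rw [Finset.sum_comm]
    refine Finset.sum_eq_zero fun i hi => ?_
    rw [Finset.sum_congr rfl (g := fun y => P.coeff i * (v y * y ^ i)) (fun y _ => by ring),
      ← Finset.mul_sum, h i (Finset.mem_range.1 hi), mul_zero]
  rw [Finset.sum_eq_single x] at h1
  · have h2 : P.eval x = 1 := Lagrange.eval_basis_self (v := fun y : F => y) hinj hx
    rwa [h2, mul_one] at h1
  · intro y hy hyx
    have h2 : P.eval y = 0 := Lagrange.eval_basis_of_ne (v := fun y : F => y) (Ne.symm hyx) hy
    rw [h2, mul_zero]
  · intro h; exact absurd hx h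

/-- Lagrange weights -/
def rlW {F : Type*} [Field F] [DecidableEq F] (S : Finset F) (x : F) : F :=
  (∏ y ∈ S.erase x, (x - y))⁻¹

lemma rlW_ne {F : Type*} [Field F] [DecidableEq F] (S : Finset F) (x : F) : rlW S x ≠ 0 := by
  refine inv_ne_zero (Finset.prod_ne_zero_iff.2 fun y hy => ?_)
  exact sub_ne_zero.2 (Finset.ne_of_mem_erase hy).symm

lemma rlW_sum {F : Type*} [Field F] [DecidableEq F] (S : Finset F) (P : F[X])
    (hP : P.degree < S.card) : ∑ x ∈ S, rlW S x * P.eval x = P.coeff (S.card - 1) := by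
  rw [Lagrange.coeff_eq_sum (v := fun y : F => y) (s := S) (fun _ _ _ _ h => h) hP]
  refine Finset.sum_congr rfl fun x _ => ?_
  rw [rlW, div_eq_mul_inv, mul_comm]

lemma rlW_pow {F : Type*} [Field F] [DecidableEq F] (S : Finset F) (i : ℕ) (hi : i < S.card) :
    ∑ x ∈ S, rlW S x * x ^ i = if i = S.card - 1 then 1 else 0 := by
  have := rlW_sum S (X ^ i) (by rw [degree_X_pow]; exact_mod_cast hi)
  simp only [eval_pow, eval_X, coeff_X_pow] at this
  rw [this]
  simp only [eq_comm]

lemma rlW_pow_card {F : Type*} [Field F] [DecidableEq F] (S : Finset F) (hS : 0 < S.card) :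
    ∑ x ∈ S, rlW S x * x ^ S.card = ∑ x ∈ S, x := by
  have hd : (∏ y ∈ S, (X - C y) : F[X]).degree = S.card := by
    simpa [Lagrange.nodal] using Lagrange.degree_nodal (s := S) (v := fun y : F => y)
  have hm : (∏ y ∈ S, (X - C y) : F[X]).Monic := monic_prod_of_monic _ _ fun y _ => monic_X_sub_C y
  have := rlW_sum S (X ^ S.card - ∏ y ∈ S, (X - C y)) (by
    have h1 : (X ^ S.card : F[X]).degree = S.card := degree_X_pow _
    rw [← h1]
    refine degree_sub_lt_left (by rw [hd, h1]) (pow_ne_zero _ X_ne_zero) ?_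
    rw [hm.leadingCoeff, (monic_X_pow _).leadingCoeff])
  rw [coeff_sub, coeff_X_pow, if_neg (by omega), prod_X_sub_C_coeff_card_pred S _ hS] at this
  simp only [zero_sub, neg_neg] at this
  rw [← this]
  refine Finset.sum_congr rfl fun x hx => ?_
  have h0 : (∏ y ∈ S, (X - C y) : F[X]).eval x = 0 := by
    rw [eval_prod]
    exact Finset.prod_eq_zero hx (by simp)
  simp [h0]

/-- the columns of the generator matrix, indexed by `Option F` -/
def rlCol {F : Type*} [Field F] [DecidableEq F] (k : ℕ) (s t r : F) (z : Option F) (i : ℕ) : F :=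
  match z with
  | none => if i = k - 1 then r else 0
  | some x => if x = 0 then (if i = k - 2 then s else if i = k - 1 then t else 0) else x ^ i

/-- membership in the dual code -/
def rlCW {F : Type*} [Field F] [Fintype F] [DecidableEq F] (k : ℕ) (s t r : F)
    (c : Option F → F) : Prop := ∀ i < k, ∑ z, c z * rlCol k s t r z i = 0

/-- affine support -/
def rlS {F : Type*} [Field F] [Fintype F] [DecidableEq F] (c : Option F → F) : Finset F :=
  (Finset.univ.erase 0).filter (fun x => c (some x) ≠ 0)

section
variable {F : Type*} [Field F] [Fintype F] [DecidableEq F]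

lemma rl_sum_eq (k : ℕ) (s t r : F) (c : Option F → F) (i : ℕ) :
    ∑ z, c z * rlCol k s t r z i = c none * (if i = k - 1 then r else 0) +
      (c (some 0) * (if i = k - 2 then s else if i = k - 1 then t else 0) +
      ∑ x ∈ rlS c, c (some x) * x ^ i) := by
  rw [Fintype.sum_option, ← Finset.add_sum_erase _ _ (Finset.mem_univ (0 : F))]
  congr 1
  congr 1
  · simp [rlCol]
  · rw [rlS, Finset.sum_filter]
    refine Finset.sum_congr rfl fun x hx => ?_
    have := Finset.ne_of_mem_erase hx
    by_cases h : c (some x) = 0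
    · simp [h]
    · simp [h, rlCol, this]

lemma rl_norm (c : Option F → F) : hammingNorm c = (if c none ≠ 0 then 1 else 0) +
    ((if c (some 0) ≠ 0 then 1 else 0) + (rlS c).card) := by
  have : hammingNorm c = ∑ z, if c z ≠ 0 then 1 else 0 := by
    rw [hammingNorm, Finset.card_filter]
  rw [this, Fintype.sum_option, ← Finset.add_sum_erase _ _ (Finset.mem_univ (0 : F)), rlS,
    Finset.card_filter]

lemma rl_S_zero {k : ℕ} {s t r : F} {c : Option F → F}
    (hS : (rlS c).card = 0) (hk : 2 ≤ k) (hs : s ≠ 0) (hr : r ≠ 0) (h : rlCW k s t r c) : c = 0 := by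
  have hSe := Finset.card_eq_zero.1 hS
  have h1 := h (k - 2) (by omega)
  have h2 := h (k - 1) (by omega)
  rw [rl_sum_eq, hSe] at h1 h2
  rw [if_neg (by omega), if_pos rfl] at h1
  rw [if_pos rfl, if_neg (by omega), if_pos rfl] at h2
  simp [hs] at h1
  simp [h1, hr] at h2
  funext z
  match z with
  | none => exact h2
  | some x =>
    by_cases hx : x = 0
    · rw [hx]; exact h1
    · by_contra hne
      have : x ∈ rlS c := by simp [rlS, hx]; exact hne
      rw [hSe] at this
      simp at this

lemma rl_S_all {c : Option F → F} (h : ∀ i < (rlS c).card, ∑ x ∈ rlS c, c (some x) * x ^ i = 0) :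
    (rlS c).card = 0 := by
  have h1 := rl_vand (rlS c) (fun x => c (some x)) h
  rw [Finset.card_eq_zero, Finset.eq_empty_iff_forall_notMem]
  intro x hx
  exact (Finset.mem_filter.1 hx).2 (h1 x hx)

lemma rl_S_ge {k : ℕ} {s t r : F} {c : Option F → F} (hk : 2 ≤ k) (hs : s ≠ 0) (hr : r ≠ 0)
    (h : rlCW k s t r c) (hc : c ≠ 0) :
    k - 1 ≤ (rlS c).card ∧ ((rlS c).card = k - 1 → c (some 0) ≠ 0) ∧
      ((rlS c).card = k → c (some 0) = 0 → c none ≠ 0) := by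
  refine ⟨?_, ?_, ?_⟩
  · by_contra! hlt
    refine hc (rl_S_zero (rl_S_all fun i hi => ?_) hk hs hr h)
    have := h i (by omega)
    rw [rl_sum_eq, if_neg (by omega), if_neg (by omega), if_neg (by omega)] at this
    simpa using this
  · intro hcard h0
    refine hc (rl_S_zero (rl_S_all fun i hi => ?_) hk hs hr h)
    have := h i (by omega)
    rw [rl_sum_eq, if_neg (by omega), h0] at this
    simpa using this
  · intro hcard h0 hn
    refine hc (rl_S_zero (rl_S_all fun i hi => ?_) hk hs hr h)
    have := h i (by omega)
    rw [rl_sum_eq, h0, hn] at this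
    simpa using this

lemma rl_min {k : ℕ} {s t r : F} {c : Option F → F} (hk : 2 ≤ k) (hs : s ≠ 0) (hr : r ≠ 0)
    (h : rlCW k s t r c) (hc : c ≠ 0) : k ≤ hammingNorm c := by
  obtain ⟨h1, h2, _⟩ := rl_S_ge hk hs hr h hc
  rw [rl_norm]
  by_cases hS : (rlS c).card = k - 1
  · rw [if_pos (h2 hS)]; omega
  · omega

/-- weight-`k` codewords -/
def rlPhi (s : F) (y : Finset F × F) (z : Option F) : F :=
  match z with
  | none => 0
  | some x => if x = 0 then y.2 else if x ∈ y.1 then -(s * y.2 * rlW y.1 x) else 0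

lemma rl_phi_S {s : F} (hs : s ≠ 0) (y : Finset F × F) (h0 : (0 : F) ∉ y.1) (hy : y.2 ≠ 0) :
    rlS (rlPhi s y) = y.1 := by
  ext x
  rw [rlS, Finset.mem_filter, Finset.mem_erase]
  constructor
  · rintro ⟨⟨hx, _⟩, h⟩
    by_contra hn
    simp [rlPhi, hx, hn] at h
  · intro hx
    have hx0 : x ≠ 0 := by rintro rfl; exact h0 hx
    simp [rlPhi, hx0, hx, hs, hy, rlW_ne]

lemma rl_phi_mem {k : ℕ} {s t r : F} (hk : 2 ≤ k) (hs : s ≠ 0) (y : Finset F × F)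
    (h : y ∈ rlN (k - 1) (t / s) ×ˢ Finset.univ.erase (0 : F)) :
    rlCW k s t r (rlPhi s y) ∧ hammingNorm (rlPhi s y) = k := by
  simp only [rlN, Finset.mem_product, Finset.mem_filter, Finset.mem_powersetCard,
    Finset.mem_erase, Finset.mem_univ, and_true] at h
  obtain ⟨⟨⟨hsub, hcard⟩, hsum⟩, hy⟩ := h
  have h0 : (0 : F) ∉ y.1 := fun h => by simpa using hsub h
  have hS := rl_phi_S hs y h0 hy
  constructor
  · intro i hi
    rw [rl_sum_eq, hS]
    have hv : ∑ x ∈ y.1, rlPhi s y (some x) * x ^ i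
        = -(s * y.2) * ∑ x ∈ y.1, rlW y.1 x * x ^ i := by
      rw [Finset.mul_sum]
      refine Finset.sum_congr rfl fun x hx => ?_
      have hx0 : x ≠ 0 := by rintro rfl; exact h0 hx
      simp [rlPhi, hx0, hx]
      ring
    rw [hv]
    have e1 : rlPhi s y none = 0 := rfl
    have e2 : rlPhi s y (some 0) = y.2 := by simp [rlPhi]
    rw [e1, e2]
    by_cases hik : i = k - 1
    · subst hik
      have := rlW_pow_card y.1 (by omega)
      rw [hcard] at this
      rw [this, hsum, if_neg (by omega : ¬ k - 1 = k - 2), zero_mul, if_pos rfl]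
      field_simp
      ring
    · rw [rlW_pow _ _ (by omega), hcard, if_neg hik, if_neg hik]
      by_cases h2 : i = k - 2
      · rw [if_pos h2, if_pos (by omega)]; ring
      · rw [if_neg h2, if_neg (by omega)]; ring
  · rw [rl_norm, hS, hcard]
    simp [rlPhi, hy]
    omega

lemma rl_phi_surj {k : ℕ} {s t r : F} (hk : 2 ≤ k) (hs : s ≠ 0) (hr : r ≠ 0) (c : Option F → F)
    (h : rlCW k s t r c) (hw : hammingNorm c = k) :
    ∃ y ∈ rlN (k - 1) (t / s) ×ˢ Finset.univ.erase (0 : F), rlPhi s y = c := by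
  have hc : c ≠ 0 := by
    rintro rfl
    rw [hammingNorm_zero] at hw
    omega
  obtain ⟨h1, h2, h3⟩ := rl_S_ge hk hs hr h hc
  rw [rl_norm] at hw
  have hcard : (rlS c).card = k - 1 := by
    by_contra hne
    have hk' : (rlS c).card = k := by omega
    have h0 : c (some 0) = 0 := by
      by_contra h0; rw [if_pos h0] at hw; omega
    rw [if_pos (h3 hk' h0)] at hw
    omega
  have h0 := h2 hcard
  have hn : c none = 0 := by
    by_contra hn; rw [if_pos h0, if_pos hn] at hw; omega
  have hv := rl_vand (rlS c) (fun x => c (some x) + s * c (some 0) * rlW (rlS c) x) (by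
    intro i hi
    have e := h i (by omega)
    rw [rl_sum_eq, hn, zero_mul, zero_add] at e
    have e2 := rlW_pow (rlS c) i hi
    rw [Finset.sum_congr rfl (g := fun x => c (some x) * x ^ i
      + s * c (some 0) * (rlW (rlS c) x * x ^ i)) (fun x _ => by ring),
      Finset.sum_add_distrib, ← Finset.mul_sum, e2, hcard, eq_neg_of_add_eq_zero_right e]
    by_cases h2 : i = k - 2
    · rw [if_pos h2, if_pos (by omega)]; ring
    · rw [if_neg h2, if_neg (by omega), if_neg (by omega)]; ring)
  have hv' : ∀ x ∈ rlS c, c (some x) = -(s * c (some 0) * rlW (rlS c) x) :=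
    fun x hx => eq_neg_of_add_eq_zero_left (hv x hx)
  have hsum : ∑ x ∈ rlS c, x = t / s := by
    have e := h (k - 1) (by omega)
    rw [rl_sum_eq, hn, zero_mul, zero_add, if_neg (by omega), if_pos rfl] at e
    have e2 := rlW_pow_card (rlS c) (by omega)
    rw [hcard] at e2
    rw [Finset.sum_congr rfl (g := fun x => -(s * c (some 0)) * (rlW (rlS c) x * x ^ (k - 1)))
      (fun x hx => by rw [hv' x hx]; ring), ← Finset.mul_sum, e2] at e
    have e3 : c (some 0) * (t - s * ∑ x ∈ rlS c, x) = 0 := by linear_combination e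
    have e4 := (mul_eq_zero.1 e3).resolve_left h0
    rw [eq_div_iff hs]
    linear_combination -e4
  refine ⟨(rlS c, c (some 0)), ?_, ?_⟩
  · simp only [rlN, Finset.mem_product, Finset.mem_filter, Finset.mem_powersetCard,
      Finset.mem_erase, Finset.mem_univ, and_true]
    exact ⟨⟨⟨Finset.filter_subset _ _, hcard⟩, hsum⟩, h0⟩
  · funext z
    match z with
    | none => exact hn.symm
    | some x =>
      by_cases hx : x = 0
      · simp [rlPhi, hx]
      · by_cases hxS : x ∈ rlS c
        · simp only [rlPhi, hx, hxS, if_true, if_false]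
          exact (hv' x hxS).symm
        · simp only [rlPhi, hx, hxS, if_false]
          by_contra hne
          exact hxS (by simp [rlS, hx]; exact fun h => hne h.symm)

lemma rl_ncard {k : ℕ} {s t r : F} (hk : 2 ≤ k) (hs : s ≠ 0) (hr : r ≠ 0) :
    {c : Option F → F | rlCW k s t r c ∧ hammingNorm c = k}.ncard
      = (rlN (k - 1) (t / s)).card * (Fintype.card F - 1) := by
  have : {c : Option F → F | rlCW k s t r c ∧ hammingNorm c = k}
      = rlPhi s '' ((rlN (k - 1) (t / s) ×ˢ Finset.univ.erase (0 : F) : Finset _) : Set _) := by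
    ext c
    constructor
    · rintro ⟨h1, h2⟩
      obtain ⟨y, hy, rfl⟩ := rl_phi_surj hk hs hr c h1 h2
      exact ⟨y, hy, rfl⟩
    · rintro ⟨y, hy, rfl⟩
      exact rl_phi_mem hk hs y hy
  rw [this, Set.InjOn.ncard_image, Set.ncard_coe_finset, Finset.card_product,
    Finset.card_erase_of_mem (Finset.mem_univ _), Finset.card_univ]
  intro y hy z hz hyz
  have key : ∀ y ∈ ((rlN (k - 1) (t / s) ×ˢ Finset.univ.erase (0 : F) : Finset _) : Set _),
      rlS (rlPhi s y) = y.1 ∧ rlPhi s y (some 0) = y.2 := by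
    intro y hy
    rw [Finset.mem_coe] at hy
    simp only [rlN, Finset.mem_product, Finset.mem_filter, Finset.mem_powersetCard,
      Finset.mem_erase, Finset.mem_univ, and_true] at hy
    refine ⟨rl_phi_S hs y (fun h => by simpa using hy.1.1.1 h) hy.2, by simp [rlPhi]⟩
  obtain ⟨a1, a2⟩ := key y hy
  obtain ⟨b1, b2⟩ := key z hz
  rw [hyz] at a1 a2
  exact Prod.ext (a1.symm.trans b1) (a2.symm.trans b2)
end


lemma rl_dual_iff {F : Type*} [Field F] {k N : ℕ} (G : Matrix (Fin k) (Fin N) F) (c : Fin N → F) :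
    (∀ y : Fin N → F, (∃ x : Fin k → F, y = Matrix.vecMul x G) → ∑ i, c i * y i = 0) ↔
      ∀ i : Fin k, ∑ j, c j * G i j = 0 := by
  constructor
  · intro h i
    have := h _ ⟨Pi.single i 1, rfl⟩
    simpa [Matrix.single_one_vecMul] using this
  · rintro h y ⟨x, rfl⟩
    simp only [Matrix.vecMul, dotProduct, Finset.mul_sum]
    rw [Finset.sum_comm]
    refine Finset.sum_eq_zero fun i _ => ?_
    rw [Finset.sum_congr rfl (g := fun j => x i * (c j * G i j)) (fun j _ => by ring),
      ← Finset.mul_sum, h i, mul_zero]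

lemma rl_transport {F : Type*} [Field F] [Fintype F] [DecidableEq F] {k N : ℕ} {s t r : F}
    (G : Matrix (Fin k) (Fin N) F) (e : Fin N ≃ Option F)
    (hG : ∀ i j, G i j = rlCol k s t r (e j) i) (c : Option F → F) :
    (∀ y : Fin N → F, (∃ x : Fin k → F, y = Matrix.vecMul x G) → ∑ i, (c ∘ e) i * y i = 0) ↔
      rlCW k s t r c := by
  rw [rl_dual_iff]
  have : ∀ i : Fin k, ∑ j, (c ∘ e) j * G i j = ∑ z, c z * rlCol k s t r z i := by
    intro i
    rw [← Equiv.sum_comp e]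
    exact Finset.sum_congr rfl fun j _ => by rw [hG]; rfl
  simp_rw [this]
  exact ⟨fun h i hi => h ⟨i, hi⟩, fun h i => h i i.2⟩

lemma rl_norm_comp {F : Type*} [Field F] [Fintype F] [DecidableEq F] {N : ℕ}
    (e : Fin N ≃ Option F) (c : Option F → F) : hammingNorm (c ∘ e) = hammingNorm c := by
  rw [hammingNorm, hammingNorm, Finset.card_filter, Finset.card_filter]
  exact Equiv.sum_comp e (fun z => if c z ≠ 0 then 1 else 0)

lemma rl_main {F : Type*} [Field F] [Fintype F] [DecidableEq F] {p n k N : ℕ} (hp : p.Prime)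
    [CharP F p] (hn : Fintype.card F = p * (n + 1)) (hk : 2 ≤ k) (hk2 : k - 1 < Fintype.card F - 1)
    {s t r : F} (hs : s ≠ 0) (ht : t ≠ 0) (hr : r ≠ 0)
    (G : Matrix (Fin k) (Fin N) F) (e : Fin N ≃ Option F)
    (hG : ∀ i j, G i j = rlCol k s t r (e j) i) :
    ((∃ c : Fin N → F,
        (∀ y : Fin N → F, (∃ x : Fin k → F, y = Matrix.vecMul x G) →
          ∑ i, c i * y i = 0) ∧ c ≠ 0 ∧ hammingNorm c = k) ∧
      (∀ c : Fin N → F,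
        (∀ y : Fin N → F, (∃ x : Fin k → F, y = Matrix.vecMul x G) →
          ∑ i, c i * y i = 0) → c ≠ 0 → k ≤ hammingNorm c)) ∧
    (Fintype.card F : ℚ) * ({c : Fin N → F |
        (∀ y : Fin N → F, (∃ x : Fin k → F, y = Matrix.vecMul x G) →
          ∑ i, c i * y i = 0) ∧ hammingNorm c = k}.ncard : ℚ) =
      ((Fintype.card F : ℚ) - 1) * ((Fintype.card F - 1).choose (k - 1)
      - (-1) ^ ((k - 1) + (k - 1) / p) * (n.choose ((k - 1) / p))) := by
  have hts : t / s ≠ 0 := div_ne_zero ht hs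
  have hinj : Function.Injective (fun c : Option F → F => c ∘ e) :=
    e.surjective.injective_comp_right
  have hsurj : ∀ c : Fin N → F, ∃ c' : Option F → F, c = c' ∘ e :=
    fun c => ⟨c ∘ e.symm, by funext j; simp⟩
  have hset : {c : Fin N → F |
        (∀ y : Fin N → F, (∃ x : Fin k → F, y = Matrix.vecMul x G) →
          ∑ i, c i * y i = 0) ∧ hammingNorm c = k}
      = (fun c : Option F → F => c ∘ e) '' {c | rlCW k s t r c ∧ hammingNorm c = k} := by
    ext c
    obtain ⟨c', rfl⟩ := hsurj c
    constructor
    · rintro ⟨h1, h2⟩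
      exact ⟨c', ⟨(rl_transport G e hG c').1 h1, by rw [← rl_norm_comp e]; exact h2⟩, rfl⟩
    · rintro ⟨c'', ⟨h1, h2⟩, h3⟩
      obtain rfl := hinj h3
      exact ⟨(rl_transport G e hG _).2 h1, by rw [rl_norm_comp e]; exact h2⟩
  refine ⟨⟨?_, ?_⟩, ?_⟩
  · obtain ⟨S, hS⟩ := rlN_nonempty (F := F) (k - 1) (t / s) hts (by omega) hk2
    obtain ⟨h1, h2⟩ := rl_phi_mem (t := t) (r := r) hk hs (S, (1 : F)) (by simp [hS])
    refine ⟨rlPhi s (S, 1) ∘ e, (rl_transport G e hG _).2 h1, ?_, by rw [rl_norm_comp, h2]⟩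
    intro h
    have h3 := rl_norm_comp e (rlPhi s (S, (1 : F)))
    rw [h, h2, hammingNorm_zero] at h3
    omega
  · intro c hc hne
    obtain ⟨c', rfl⟩ := hsurj c
    rw [rl_norm_comp]
    refine rl_min hk hs hr ((rl_transport G e hG c').1 hc) ?_
    rintro rfl
    exact hne rfl
  · rw [hset, Set.ncard_image_of_injective _ hinj, rl_ncard hk hs hr,
      ← rlN_count hp n hn (k - 1) (t / s) hts]
    have : 1 ≤ Fintype.card F := Fintype.card_pos
    push_cast [Nat.cast_sub this]
    ring

/-- the column labelling -/
def rlLab {F : Type*} [Field F] {q : ℕ} (β : Fin (q - 1) → F) (u : ℕ) (j : Fin (q + 1)) :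
    Option F := if h : (j : ℕ) < q - 1 then some (β ⟨j, h⟩) else if (j : ℕ) = u then some 0 else none

lemma rlLab_bij {F : Type*} [Field F] [Fintype F] {q : ℕ} (hF : Fintype.card F = q)
    (β : Fin (q - 1) → F) (hβ : Function.Injective β) (h0 : ∀ j, β j ≠ 0) (u : ℕ)
    (hu : u = q - 1 ∨ u = q) : Function.Bijective (rlLab β u) := by
  rw [Fintype.bijective_iff_injective_and_card]
  refine ⟨?_, by simp [hF]⟩
  intro i j hij
  have hi := i.2
  have hj := j.2
  unfold rlLab at hij
  apply Fin.ext
  split_ifs at hij with h1 h2 h3 h4 h5 h6 <;> simp only [Option.some.injEq, reduceCtorEq] at hij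
  · simpa using hβ hij
  · exact absurd hij (h0 _)
  · exact absurd hij.symm (h0 _)
  all_goals omega

end

/-- exactly one of a₁₁, a₁₂ vanishes (the second row nonzero): weight-k count formula. -/
theorem stmt8 (p m q k : ℕ) (hp : p.Prime) (hm : 0 < m) (hq : q = p ^ m)
    (F : Type*) [Field F] [Fintype F] [DecidableEq F] (hF : Fintype.card F = q)
    (hrange : (p = 2 ∧ 4 ≤ k ∧ k ≤ q - 3) ∨ (Odd p ∧ 3 ≤ k ∧ k ≤ q - 2))
    (β : Fin (q - 1) → F) (hβinj : Function.Injective β)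
    (hβrange : Set.range β = {x : F | x ≠ 0})
    (a : Matrix (Fin 2) (Fin 2) F) (ha : IsUnit a.det)
    (G₁ : Matrix (Fin k) (Fin (q + 1)) F)
    (hGv : ∀ (i : Fin k) (j : Fin (q + 1)) (h : (j : ℕ) < q - 1),
      G₁ i j = β ⟨j, h⟩ ^ (i : ℕ))
    (hGc1 : ∀ (i : Fin k) (j : Fin (q + 1)), (j : ℕ) = q - 1 →
      G₁ i j = if (i : ℕ) = k - 2 then a 0 0 else if (i : ℕ) = k - 1 then a 1 0 else 0)
    (hGc2 : ∀ (i : Fin k) (j : Fin (q + 1)), (j : ℕ) = q →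
      G₁ i j = if (i : ℕ) = k - 2 then a 0 1 else if (i : ℕ) = k - 1 then a 1 1 else 0)
    (hA : (a 0 0 * a 1 0 * a 1 1 ≠ 0 ∧ a 0 1 = 0) ∨ (a 0 1 * a 1 0 * a 1 1 ≠ 0 ∧ a 0 0 = 0)) :
    ((∃ c : Fin (q + 1) → F,
        (∀ y : Fin (q + 1) → F, (∃ x : Fin k → F, y = Matrix.vecMul x G₁) →
          ∑ i, c i * y i = 0) ∧ c ≠ 0 ∧ hammingNorm c = k) ∧
      (∀ c : Fin (q + 1) → F,
        (∀ y : Fin (q + 1) → F, (∃ x : Fin k → F, y = Matrix.vecMul x G₁) →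
          ∑ i, c i * y i = 0) → c ≠ 0 → k ≤ hammingNorm c)) ∧
    (({c : Fin (q + 1) → F |
        (∀ y : Fin (q + 1) → F, (∃ x : Fin k → F, y = Matrix.vecMul x G₁) →
          ∑ i, c i * y i = 0) ∧ hammingNorm c = k}.ncard : ℚ) =
      ((q : ℚ) - 1) / q * ((q - 1).choose (k - 1) : ℚ) +
      (-1 : ℚ) ^ (k + (k - 1) / p) * (((q : ℚ) - 1) / q) *
        (((q / p - 1).choose ((k - 1) / p) : ℕ) : ℚ)) := by
  have hF0 : 0 < Fintype.card F := Fintype.card_pos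
  have hk : 3 ≤ k ∧ k ≤ q - 2 := by omega
  have := Fact.mk hp
  have hchar : CharP F p := by
    obtain ⟨p', hp'⟩ := CharP.exists F
    obtain ⟨n', hprime, hcard⟩ := FiniteField.card F p'
    have : p' = p := by
      have hd : p' ∣ p ^ m := by
        rw [← hq, ← hF, hcard]
        exact dvd_pow_self _ n'.2.ne'
      exact (Nat.prime_dvd_prime_iff_eq hprime hp).1 (hprime.dvd_of_dvd_pow hd)
    rwa [← this]
  have hqp : 0 < p ^ (m - 1) := pow_pos hp.pos _
  have hqm : q = p * p ^ (m - 1) := by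
    rw [hq, ← pow_succ']
    congr 1
    omega
  have hqd : q / p = p ^ (m - 1) := by
    rw [hqm, Nat.mul_div_cancel_left _ hp.pos]
  have hn : Fintype.card F = p * ((q / p - 1) + 1) := by
    rw [hF, hqd, Nat.sub_add_cancel hqp, ← hqm]
  have hβ0 : ∀ j, β j ≠ 0 := by
    intro j
    have : β j ∈ Set.range β := ⟨j, rfl⟩
    rw [hβrange] at this
    exact this
  have fin : ∀ (s t r : F) (u : ℕ) (hu : u = q - 1 ∨ u = q), s ≠ 0 → t ≠ 0 → r ≠ 0 →
      (∀ i j, G₁ i j = rlCol k s t r (rlLab β u j) i) → _ := fun s t r u hu hs ht hr hG =>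
    rl_main hp hn (by omega) (by omega) hs ht hr G₁
      (Equiv.ofBijective _ (rlLab_bij hF β hβinj hβ0 u hu)) hG
  have hmain : ((∃ c : Fin (q + 1) → F,
        (∀ y : Fin (q + 1) → F, (∃ x : Fin k → F, y = Matrix.vecMul x G₁) →
          ∑ i, c i * y i = 0) ∧ c ≠ 0 ∧ hammingNorm c = k) ∧
      (∀ c : Fin (q + 1) → F,
        (∀ y : Fin (q + 1) → F, (∃ x : Fin k → F, y = Matrix.vecMul x G₁) →
          ∑ i, c i * y i = 0) → c ≠ 0 → k ≤ hammingNorm c)) ∧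
    (Fintype.card F : ℚ) * ({c : Fin (q + 1) → F |
        (∀ y : Fin (q + 1) → F, (∃ x : Fin k → F, y = Matrix.vecMul x G₁) →
          ∑ i, c i * y i = 0) ∧ hammingNorm c = k}.ncard : ℚ) =
      ((Fintype.card F : ℚ) - 1) * ((Fintype.card F - 1).choose (k - 1)
      - (-1) ^ ((k - 1) + (k - 1) / p) * ((q / p - 1).choose ((k - 1) / p))) := by
    rcases hA with ⟨hne, hz⟩ | ⟨hne, hz⟩
    · simp only [ne_eq, mul_eq_zero, not_or] at hne
      refine fin (a 0 0) (a 1 0) (a 1 1) (q - 1) (Or.inl rfl) hne.1.1 hne.1.2 hne.2 ?_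
      intro i j
      have hj := j.2
      by_cases h1 : (j : ℕ) < q - 1
      · rw [hGv i j h1]
        simp [rlLab, h1, rlCol, hβ0]
      · by_cases h2 : (j : ℕ) = q - 1
        · rw [hGc1 i j h2]
          simp [rlLab, h2, rlCol]
        · rw [hGc2 i j (by omega)]
          simp only [rlLab, h1, h2, rlCol, dif_neg, not_false_eq_true, if_false, hz]
          split_ifs <;> first | rfl | omega
    · simp only [ne_eq, mul_eq_zero, not_or] at hne
      refine fin (a 0 1) (a 1 1) (a 1 0) q (Or.inr rfl) hne.1.1 hne.2 hne.1.2 ?_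
      intro i j
      have hj := j.2
      by_cases h1 : (j : ℕ) < q - 1
      · rw [hGv i j h1]
        simp [rlLab, h1, rlCol, hβ0]
      · by_cases h2 : (j : ℕ) = q
        · rw [hGc2 i j h2]
          have hlab : rlLab β q j = some 0 := by rw [rlLab, dif_neg h1, if_pos h2]
          rw [hlab]
          simp [rlCol]
        · rw [hGc1 i j (by omega)]
          simp only [rlLab, h1, h2, rlCol, dif_neg, not_false_eq_true, if_false, hz]
          split_ifs <;> first | rfl | omega
  refine ⟨hmain.1, ?_⟩
  have h2 := hmain.2
  rw [hF] at h2
  have hq0 : (q : ℚ) ≠ 0 := by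
    have : q ≠ 0 := by omega
    exact_mod_cast this
  have hsgn : (-1 : ℚ) ^ (k + (k - 1) / p) = -(-1) ^ ((k - 1) + (k - 1) / p) := by
    have : k + (k - 1) / p = ((k - 1) + (k - 1) / p) + 1 := by omega
    rw [this, pow_succ]
    ring
  rw [hsgn]
  apply mul_left_cancel₀ hq0
  rw [h2]
  field_simp
  ring
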